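/- Let (Y,X) and (Y',X') be two independent copies of the pair from the model. Then the matrix E[(Y+Y')²(X−X')(X−X')ᵀ] equals −4φ(f)·β*(β*)ᵀ + 4(1+μ₀²)·I_p. In particular, if φ(f) < 0 then β* is the leading eigenvector of this matrix. -/

import Mathlib

open MeasureTheory ProbabilityTheory

/-- The Gaussian moments `μ_k = E[f(Z) Z^k]` for `Z ~ N(0,1)`. -/
noncomputable def gaussMoment (f : ℝ → ℝ) (k : ℕ) : ℝ :=
  ∫ z, f z * z ^ k ∂(gaussianReal 0 1)

/-- `φ(f) = μ₁² − μ₀μ₂ + μ₀²`. -/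
noncomputable def phiFun (f : ℝ → ℝ) : ℝ :=
  gaussMoment f 1 ^ 2 - gaussMoment f 0 * gaussMoment f 2 + gaussMoment f 0 ^ 2

lemma _root_.MeasureTheory.Integrable.sub_lam {Ω : Type*} [MeasurableSpace Ω] {μ : Measure Ω}
    {u v : Ω → ℝ} (hu : Integrable u μ) (hv : Integrable v μ) :
    Integrable (fun ω => u ω - v ω) μ := hu.sub hv

lemma gl_of_law {Ω : Type*} [MeasurableSpace Ω] (μ : Measure Ω) [IsProbabilityMeasure μ]
    (p : ℕ) (X : Ω → Fin p → ℝ) (hXm : Measurable X)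
    (hXlaw : Measure.map X μ = Measure.pi fun _ : Fin p => gaussianReal 0 1) :
    HasGaussianLaw X μ ∧ (∀ i, ∫ ω, X ω i ∂μ = 0) ∧
    (∀ i j, ∫ ω, X ω i * X ω j ∂μ = if i = j then 1 else 0) := by
  have hXi : ∀ i, Measurable fun ω => X ω i := fun i => (measurable_pi_apply i).comp hXm
  have hm : ∀ i, Measure.map (fun ω => X ω i) μ = gaussianReal 0 1 := by
    intro i
    have := (measurePreserving_eval (fun _ : Fin p => gaussianReal 0 1) i).map_eq
    rw [← hXlaw, Measure.map_map (measurable_pi_apply i) hXm] at this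
    exact this
  have hind : iIndepFun (fun i ω => X ω i) μ := by
    rw [iIndepFun_iff_map_fun_eq_pi_map (fun i => (hXi i).aemeasurable)]
    simp_rw [hm]
    exact hXlaw
  have hmean : ∀ i, ∫ ω, X ω i ∂μ = 0 := by
    intro i
    have h := integral_map (μ := μ) (hXi i).aemeasurable (f := fun x : ℝ => x)
      measurable_id.aestronglyMeasurable
    rw [← h, hm, integral_id_gaussianReal]
  have hg : ∀ i, HasGaussianLaw (fun ω => X ω i) μ := fun i => ⟨by rw [hm]; infer_instance⟩
  refine ⟨hind.hasGaussianLaw hg, hmean, ?_⟩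
  intro i j
  split_ifs with hij
  · subst hij
    have h1 : Var[fun ω => X ω i; μ] = 1 := by
      have := variance_map (X := fun x : ℝ => x) (μ := μ) (Y := fun ω => X ω i)
        measurable_id.aemeasurable (hXi i).aemeasurable
      rw [hm] at this
      have h2 := variance_fun_id_gaussianReal (μ := 0) (v := 1)
      rw [h2] at this
      simpa [Function.comp_def] using this.symm
    rw [variance_of_integral_eq_zero (hXi i).aemeasurable (hmean i)] at h1
    rw [← h1]
    congr 1; ext ω; simp [sq]
  · rw [(hind.indepFun hij).integral_fun_mul_eq_mul_integral (hXi i).aestronglyMeasurable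
      (hXi j).aestronglyMeasurable, hmean, zero_mul]

lemma model_int {Ω : Type*} [MeasurableSpace Ω] (μ : Measure Ω) [IsProbabilityMeasure μ]
    (p : ℕ) (X : Ω → Fin p → ℝ) (Y : Ω → ℝ) (g : (Fin p → ℝ) → ℝ) (hg : Measurable g)
    (hgb : ∀ x, |g x| ≤ 1)
    (hXm : Measurable X) (hYm : Measurable Y) (hYval : ∀ ω, Y ω = 1 ∨ Y ω = -1)
    (hmodel : ∀ A : Set (Fin p → ℝ), MeasurableSet A →
      (μ ({ω | Y ω = 1} ∩ X ⁻¹' A)).toReal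
        = ∫ ω in X ⁻¹' A, (g (X ω) / 2 + 1 / 2) ∂μ)
    (h : (Fin p → ℝ) → ℝ) (hh : Measurable h) (hi : Integrable (fun ω => h (X ω)) μ) :
    ∫ ω, Y ω * h (X ω) ∂μ = ∫ ω, g (X ω) * h (X ω) ∂μ := by
  have hle : MeasurableSpace.comap X inferInstance ≤ ‹MeasurableSpace Ω› := hXm.comap_le
  have hYi : Integrable Y μ := by
    refine Integrable.of_bound hYm.aestronglyMeasurable 1 (Filter.Eventually.of_forall fun ω => ?_)
    rcases hYval ω with h | h <;> simp [h]
  have hgi : Integrable (fun ω => g (X ω)) μ :=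
    Integrable.of_bound (hg.comp hXm).aestronglyMeasurable 1
      (Filter.Eventually.of_forall fun ω => hgb _)
  have hY1 : MeasurableSet {ω | Y ω = 1} := hYm (measurableSet_singleton 1)
  have hc : (fun ω => g (X ω)) =ᵐ[μ] μ[Y | MeasurableSpace.comap X inferInstance] := by
    refine ae_eq_condExp_of_forall_setIntegral_eq hle hYi (fun s _ _ => hgi.integrableOn) ?_ ?_
    · rintro s ⟨A, hA, rfl⟩ -
      have h1 := hmodel A hA
      have hYe : ∀ ω, Y ω = 2 * ({ω | Y ω = 1}.indicator (fun _ => (1:ℝ)) ω) - 1 := by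
        intro ω
        rcases hYval ω with h | h
        · simp [Set.indicator, h]; norm_num
        · simp [Set.indicator, h]; norm_num
      have h2 : ∫ ω in X ⁻¹' A, Y ω ∂μ = 2 * (μ ({ω | Y ω = 1} ∩ X ⁻¹' A)).toReal
          - (μ (X ⁻¹' A)).toReal := by
        rw [integral_congr_ae (Filter.Eventually.of_forall hYe), integral_sub, integral_const_mul,
          integral_indicator hY1]
        · simp [Measure.real, hY1]
        · exact ((integrable_const _).indicator hY1).const_mul _
        · exact integrable_const _
      rw [h2, h1, integral_add (hgi.integrableOn.div_const 2) (integrable_const _), integral_div]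
      simp [Measure.real]; ring
    · exact ((hg.comp (comap_measurable X)).stronglyMeasurable).aestronglyMeasurable
  have hYh : Integrable (Y * fun ω => h (X ω)) μ := by
    refine hi.bdd_mul (c := 1) hYm.aestronglyMeasurable (Filter.Eventually.of_forall fun ω => ?_)
    rcases hYval ω with h | h <;> simp [h]
  have hp := condExp_mul_of_stronglyMeasurable_right (μ := μ)
    (m := MeasurableSpace.comap X inferInstance) (f := Y) (g := fun ω => h (X ω))
    (hh.comp (comap_measurable X)).stronglyMeasurable hYh hYi
  have h3 := integral_condExp hle (μ := μ) (f := Y * fun ω => h (X ω))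
  rw [integral_congr_ae hp] at h3
  have h4 : ∫ ω, Y ω * h (X ω) ∂μ = ∫ ω, (Y * fun ω => h (X ω)) ω ∂μ := rfl
  rw [h4, ← h3]
  refine integral_congr_ae ?_
  filter_upwards [hc] with ω hω
  simp [← hω]

lemma gauss_moments {Ω : Type*} [MeasurableSpace Ω] (μ : Measure Ω) [IsProbabilityMeasure μ]
    (p : ℕ) (β : Fin p → ℝ) (hβ : ∑ i, β i ^ 2 = 1)
    (f : ℝ → ℝ) (hfm : Measurable f) (hfb : ∀ z, |f z| ≤ 1)
    (X : Ω → Fin p → ℝ) (hXm : Measurable X)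
    (hXlaw : Measure.map X μ = Measure.pi fun _ : Fin p => gaussianReal 0 1) :
    (∫ ω, f (∑ i, X ω i * β i) ∂μ = gaussMoment f 0) ∧
    (∀ i, ∫ ω, f (∑ i, X ω i * β i) * X ω i ∂μ = gaussMoment f 1 * β i) ∧
    (∀ i j, ∫ ω, f (∑ i, X ω i * β i) * (X ω i * X ω j) ∂μ =
      gaussMoment f 0 * (if i = j then 1 else 0)
        + (gaussMoment f 2 - gaussMoment f 0) * (β i * β j)) := by
  obtain ⟨hG, h1, h2⟩ := gl_of_law μ p X hXm hXlaw
  have hXi : ∀ i, Measurable fun ω => X ω i := fun i => (measurable_pi_apply i).comp hXm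
  have hL : ∀ i, MemLp (fun ω => X ω i) 2 μ := fun i =>
    (HasGaussianLaw.eval (X := fun i ω => X ω i) hG i).memLp_two
  have hmul : ∀ {u v : Ω → ℝ}, MemLp u 2 μ → MemLp v 2 μ → Integrable (fun ω => u ω * v ω) μ :=
    fun hu hv => hu.integrable_mul hv
  set W : Ω → ℝ := fun ω => ∑ i, X ω i * β i with hW
  have hWm : Measurable W := by
    exact Finset.measurable_sum _ fun i _ => (hXi i).mul_const _
  have hWL : MemLp W 2 μ := by
    refine memLp_finsetSum _ fun i _ => ?_
    simpa [mul_comm] using (hL i).const_mul (β i)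
  set R : Fin p → Ω → ℝ := fun i ω => X ω i - β i * W ω with hR
  have hRm : ∀ i, Measurable (R i) := fun i => (hXi i).sub (hWm.const_mul _)
  have hRL : ∀ i, MemLp (R i) 2 μ := fun i => (hL i).sub (hWL.const_mul _)
  have hWG : HasGaussianLaw W μ := by
    have := hG.map (∑ i, β i • ContinuousLinearMap.proj (R := ℝ) (φ := fun _ : Fin p => ℝ) i)
    convert! this using 1
    ext ω; simp [hW, mul_comm]
  have hXW : ∀ i, ∫ ω, X ω i * W ω ∂μ = β i := by
    intro i
    have : ∀ ω, X ω i * W ω = ∑ j, (X ω i * X ω j) * β j := by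
      intro ω; simp only [hW, Finset.mul_sum, mul_assoc]
    simp_rw [this]
    rw [integral_finsetSum _ fun j _ => (hmul (hL i) (hL j)).mul_const _]
    simp_rw [integral_mul_const, h2]
    simp
  have hW0 : ∫ ω, W ω ∂μ = 0 := by
    simp only [hW]
    rw [integral_finsetSum _ fun j _ => ((hL j).integrable (by norm_num)).mul_const _]
    simp_rw [integral_mul_const, h1]
    simp
  have hWW : ∫ ω, W ω * W ω ∂μ = 1 := by
    have : ∀ ω, W ω * W ω = ∑ j, (X ω j * W ω) * β j := by
      intro ω
      conv_lhs => enter [1]; rw [hW]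
      simp only [Finset.sum_mul]
      exact Finset.sum_congr rfl fun i _ => by ring
    simp_rw [this]
    rw [integral_finsetSum _ fun j _ => (hmul (hL j) hWL).mul_const _]
    simp_rw [integral_mul_const, hXW]
    rw [← hβ]
    exact Finset.sum_congr rfl fun i _ => by ring
  have hR0 : ∀ i, ∫ ω, R i ω ∂μ = 0 := by
    intro i
    simp only [hR]
    rw [integral_sub ((hL i).integrable (by norm_num))
      ((hWL.integrable (by norm_num)).const_mul _), integral_const_mul, h1, hW0]
    simp
  have hRW : ∀ i, ∫ ω, R i ω * W ω ∂μ = 0 := by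
    intro i
    have : ∀ ω, R i ω * W ω = X ω i * W ω - β i * (W ω * W ω) := fun ω => by simp only [hR]; ring
    simp_rw [this]
    rw [integral_sub (hmul (hL i) hWL)
      ((hmul hWL hWL).const_mul _), integral_const_mul, hXW, hWW]
    simp
  have hRR : ∀ i j, ∫ ω, R i ω * R j ω ∂μ = (if i = j then 1 else 0) - β i * β j := by
    intro i j
    have : ∀ ω, R i ω * R j ω = X ω i * X ω j - β i * (X ω j * W ω) - β j * (R i ω * W ω) :=
      fun ω => by simp only [hR]; ring
    simp_rw [this]
    rw [integral_sub ((hmul (hL i) (hL j)).sub_lam ((hmul (hL j) hWL).const_mul _))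
      ((hmul (hRL i) hWL).const_mul _),
      integral_sub (hmul (hL i) (hL j)) ((hmul (hL j) hWL).const_mul _),
      integral_const_mul, integral_const_mul, hXW, hRW, h2]
    simp
  have hWlaw : Measure.map W μ = gaussianReal 0 1 := by
    rw [hWG.map_eq_gaussianReal, hW0, variance_of_integral_eq_zero hWm.aemeasurable hW0]
    have : ∫ ω, (W ^ 2) ω ∂μ = 1 := by
      rw [← hWW]; congr 1; ext ω; simp [sq]
    simp_all
  have hmom : ∀ k, ∫ ω, f (W ω) * W ω ^ k ∂μ = gaussMoment f k := by
    intro k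
    rw [gaussMoment, ← hWlaw, integral_map hWm.aemeasurable]
    exact (hfm.mul (measurable_id.pow_const k)).aestronglyMeasurable
  have hind : IndepFun (fun ω i => R i ω) (fun ω (_ : Unit) => W ω) μ := by
    refine HasGaussianLaw.indepFun_of_covariance_eval (X := R) (Y := fun _ : Unit => W) ?_ ?_
    · let LW : (Fin p → ℝ) →L[ℝ] ℝ :=
        ∑ i, β i • ContinuousLinearMap.proj (R := ℝ) (φ := fun _ : Fin p => ℝ) i
      have := hG.map ((ContinuousLinearMap.pi fun i =>
        ContinuousLinearMap.proj (R := ℝ) (φ := fun _ : Fin p => ℝ) i - β i • LW).prod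
          (ContinuousLinearMap.pi fun _ : Unit => LW))
      convert! this using 1
      ext ω
      · simp [hR, hW, LW, mul_comm]
      · simp [hW, LW, mul_comm]
    · intro i _
      rw [covariance_eq_sub (hRL i) hWL, hR0]
      simpa using hRW i
  have key : ∀ (u : (Fin p → ℝ) → ℝ) (v : ℝ → ℝ), Measurable u → Measurable v →
      ∫ ω, u (fun i => R i ω) * v (W ω) ∂μ = (∫ ω, u (fun i => R i ω) ∂μ) * ∫ ω, v (W ω) ∂μ := by
    intro u v hu hv
    have := hind.comp hu (hv.comp (measurable_pi_apply ()))
    exact this.integral_fun_mul_eq_mul_integral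
      (hu.comp (measurable_pi_lambda _ hRm)).aestronglyMeasurable (hv.comp hWm).aestronglyMeasurable
  have hfW : ∀ {u : Ω → ℝ}, Integrable u μ → Integrable (fun ω => f (W ω) * u ω) μ := by
    intro u hu
    exact hu.bdd_mul (c := 1) (hfm.comp hWm).aestronglyMeasurable
      (Filter.Eventually.of_forall fun ω => hfb _)
  have m0 := hmom 0
  have m1 := hmom 1
  have m2 := hmom 2
  simp only [pow_zero, mul_one, pow_one] at m0 m1
  have k1 : ∀ i, ∫ ω, f (W ω) * R i ω ∂μ = 0 := by
    intro i
    have := key (fun r => r i) f (measurable_pi_apply i) hfm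
    simp only [hR0, zero_mul] at this
    simpa [mul_comm] using this
  have k2 : ∀ i, ∫ ω, f (W ω) * (R i ω * W ω) ∂μ = 0 := by
    intro i
    have := key (fun r => r i) (fun w => f w * w) (measurable_pi_apply i) (hfm.mul measurable_id)
    simp only [hR0, zero_mul] at this
    rw [← this]
    congr 1; ext ω; ring
  have k3 : ∀ i j, ∫ ω, f (W ω) * (R i ω * R j ω) ∂μ =
      ((if i = j then 1 else 0) - β i * β j) * gaussMoment f 0 := by
    intro i j
    have := key (fun r => r i * r j) f
      ((measurable_pi_apply i).mul (measurable_pi_apply j)) hfm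
    simp only [hRR, m0] at this
    rw [← this]
    congr 1; ext ω; ring
  refine ⟨m0, fun i => ?_, fun i j => ?_⟩
  · have : ∀ ω, f (W ω) * X ω i = f (W ω) * R i ω + β i * (f (W ω) * W ω) := fun ω => by
      simp only [hR]; ring
    change ∫ ω, f (W ω) * X ω i ∂μ = _
    simp_rw [this]
    rw [integral_add (hfW ((hRL i).integrable (by norm_num)))
      ((hfW (hWL.integrable (by norm_num))).const_mul _), integral_const_mul, k1, m1]
    ring
  · have : ∀ ω, f (W ω) * (X ω i * X ω j) = f (W ω) * (R i ω * R j ω)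
        + β j * (f (W ω) * (R i ω * W ω)) + β i * (f (W ω) * (R j ω * W ω))
        + (β i * β j) * (f (W ω) * W ω ^ 2) := fun ω => by
      simp only [hR]; ring
    change ∫ ω, f (W ω) * (X ω i * X ω j) ∂μ = _
    have i1 : Integrable (fun ω => f (W ω) * (R i ω * R j ω)) μ :=
      hfW (hmul (hRL i) (hRL j))
    have i2 : ∀ i, Integrable (fun ω => f (W ω) * (R i ω * W ω)) μ := fun i =>
      hfW (hmul (hRL i) hWL)
    have i3 : Integrable (fun ω => f (W ω) * W ω ^ 2) μ :=
      hfW (hWL.integrable_sq)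
    simp_rw [this]
    rw [integral_add ((i1.fun_add ((i2 i).const_mul _)).fun_add ((i2 j).const_mul _)) (i3.const_mul _),
      integral_add (i1.fun_add ((i2 i).const_mul _)) ((i2 j).const_mul _),
      integral_add i1 ((i2 i).const_mul _), integral_const_mul, integral_const_mul,
      integral_const_mul, k2, k2, k3, m2]
    ring

/-- If `(Y,X)` and `(Y',X')` are independent copies of the pair from the model
`P(Y = 1 | X = x) = f(⟨x,β*⟩)/2 + 1/2` with `X ~ N(0, I_p)` and `β* ∈ S^{p−1}`, then
`E[(Y+Y')²(X−X')(X−X')ᵀ] = −4φ(f)·β*β*ᵀ + 4(1+μ₀²)·I_p`. In particular, if `φ(f) < 0`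
then `β*` is the leading eigenvector of this matrix. -/
theorem second_moment_sum_matrix
    {Ω : Type*} [MeasurableSpace Ω] (μ : Measure Ω) [IsProbabilityMeasure μ]
    (p : ℕ) (β : Fin p → ℝ) (hβ : ∑ i, β i ^ 2 = 1)
    (f : ℝ → ℝ) (hfm : Measurable f) (hfb : ∀ z, f z ∈ Set.Icc (-1 : ℝ) 1)
    (X X' : Ω → Fin p → ℝ) (Y Y' : Ω → ℝ)
    (hXm : Measurable X) (hX'm : Measurable X') (hYm : Measurable Y) (hY'm : Measurable Y')
    (hYval : ∀ ω, Y ω = 1 ∨ Y ω = -1)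
    (hXlaw : Measure.map X μ = Measure.pi fun _ : Fin p => gaussianReal 0 1)
    (hmodel : ∀ A : Set (Fin p → ℝ), MeasurableSet A →
      (μ ({ω | Y ω = 1} ∩ X ⁻¹' A)).toReal
        = ∫ ω in X ⁻¹' A, (f (∑ i, X ω i * β i) / 2 + 1 / 2) ∂μ)
    (hident : Measure.map (fun ω => (Y ω, X ω)) μ = Measure.map (fun ω => (Y' ω, X' ω)) μ)
    (hindep : IndepFun (fun ω => (Y ω, X ω)) (fun ω => (Y' ω, X' ω)) μ)
    (M : Matrix (Fin p) (Fin p) ℝ)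
    (hM : ∀ i j, M i j
      = ∫ ω, (Y ω + Y' ω) ^ 2 * ((X ω i - X' ω i) * (X ω j - X' ω j)) ∂μ) :
    (M = Matrix.of fun i j =>
        -4 * phiFun f * (β i * β j)
          + 4 * (1 + gaussMoment f 0 ^ 2) * (if i = j then 1 else 0)) ∧
    (phiFun f < 0 →
      M.mulVec β = (-4 * phiFun f + 4 * (1 + gaussMoment f 0 ^ 2)) • β ∧
      ∀ v : Fin p → ℝ, (∑ i, v i * β i) = 0 →
        M.mulVec v = (4 * (1 + gaussMoment f 0 ^ 2)) • v) := by
  have hfb' : ∀ z, |f z| ≤ 1 := fun z => abs_le.2 (hfb z)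
  obtain ⟨hG, h1, h2⟩ := gl_of_law μ p X hXm hXlaw
  obtain ⟨g0, g1, g2⟩ := gauss_moments μ p β hβ f hfm hfb' X hXm hXlaw
  have hXi : ∀ i, Measurable fun ω => X ω i := fun i => (measurable_pi_apply i).comp hXm
  have hL : ∀ i, MemLp (fun ω => X ω i) 2 μ := fun i =>
    (HasGaussianLaw.eval (X := fun i ω => X ω i) hG i).memLp_two
  have hI1 : ∀ i, Integrable (fun ω => X ω i) μ := fun i => (hL i).integrable (by norm_num)
  have hI2 : ∀ i j, Integrable (fun ω => X ω i * X ω j) μ := fun i j =>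
    (hL i).integrable_mul (hL j)
  have hYb : ∀ {u : Ω → ℝ}, Integrable u μ → Integrable (fun ω => Y ω * u ω) μ := by
    intro u hu
    refine hu.bdd_mul (c := 1) hYm.aestronglyMeasurable (Filter.Eventually.of_forall fun ω => ?_)
    rcases hYval ω with h | h <;> simp [h]
  have hmod := model_int μ p X Y (fun x => f (∑ i, x i * β i))
    (hfm.comp (Finset.measurable_sum _ fun i _ => (measurable_pi_apply i).mul_const _))
    (fun x => hfb' _) hXm hYm hYval hmodel
  have y0 : ∫ ω, Y ω ∂μ = gaussMoment f 0 := by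
    have := hmod (fun _ => 1) measurable_const (integrable_const _)
    simpa [g0] using this
  have y1 : ∀ i, ∫ ω, Y ω * X ω i ∂μ = gaussMoment f 1 * β i := by
    intro i
    rw [← g1 i]
    exact hmod (fun x => x i) (measurable_pi_apply i) (hI1 i)
  have y2 : ∀ i j, ∫ ω, Y ω * (X ω i * X ω j) ∂μ = gaussMoment f 0 * (if i = j then 1 else 0)
        + (gaussMoment f 2 - gaussMoment f 0) * (β i * β j) := by
    intro i j
    rw [← g2 i j]
    exact hmod (fun x => x i * x j) ((measurable_pi_apply i).mul (measurable_pi_apply j)) (hI2 i j)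
  have hPm : Measurable fun ω => (Y ω, X ω) := hYm.prodMk hXm
  have hPm' : Measurable fun ω => (Y' ω, X' ω) := hY'm.prodMk hX'm
  have hY'val : ∀ᵐ ω ∂μ, Y' ω = 1 ∨ Y' ω = -1 := by
    have hS : MeasurableSet {q : ℝ × (Fin p → ℝ) | q.1 = 1 ∨ q.1 = -1} :=
      (measurable_fst (measurableSet_singleton 1)).union
        (measurable_fst (measurableSet_singleton (-1)))
    have : ∀ᵐ q ∂(Measure.map (fun ω => (Y' ω, X' ω)) μ), q.1 = 1 ∨ q.1 = -1 := by
      rw [← hident, ae_map_iff hPm.aemeasurable hS]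
      exact Filter.Eventually.of_forall hYval
    exact (ae_map_iff hPm'.aemeasurable hS).1 this
  have tr : ∀ (v : ℝ × (Fin p → ℝ) → ℝ), Measurable v → Integrable (fun ω => v (Y ω, X ω)) μ →
      Integrable (fun ω => v (Y' ω, X' ω)) μ ∧
        ∫ ω, v (Y' ω, X' ω) ∂μ = ∫ ω, v (Y ω, X ω) ∂μ := by
    intro v hv hi
    constructor
    · have h3 := (integrable_map_measure hv.aestronglyMeasurable hPm.aemeasurable).2 hi
      rw [hident] at h3
      exact (integrable_map_measure hv.aestronglyMeasurable hPm'.aemeasurable).1 h3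
    · rw [← integral_map hPm.aemeasurable hv.aestronglyMeasurable, hident,
        integral_map hPm'.aemeasurable hv.aestronglyMeasurable]
  have T : ∀ (u v : ℝ × (Fin p → ℝ) → ℝ), Measurable u → Measurable v →
      Integrable (fun ω => u (Y ω, X ω)) μ → Integrable (fun ω => v (Y ω, X ω)) μ →
      Integrable (fun ω => u (Y ω, X ω) * v (Y' ω, X' ω)) μ ∧
      ∫ ω, u (Y ω, X ω) * v (Y' ω, X' ω) ∂μ
        = (∫ ω, u (Y ω, X ω) ∂μ) * ∫ ω, v (Y ω, X ω) ∂μ := by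
    intro u v hu hv hui hvi
    obtain ⟨hvi', hve⟩ := tr v hv hvi
    have hi := hindep.comp hu hv
    refine ⟨hi.integrable_mul hui hvi', ?_⟩
    rw [← hve]
    exact hi.integral_fun_mul_eq_mul_integral hui.aestronglyMeasurable hvi'.aestronglyMeasurable
  have mX : ∀ i, Measurable fun q : ℝ × (Fin p → ℝ) => q.2 i := fun i =>
    (measurable_pi_apply i).comp measurable_snd
  have mXX : ∀ i j, Measurable fun q : ℝ × (Fin p → ℝ) => q.2 i * q.2 j := fun i j =>
    (mX i).mul (mX j)
  have mY : Measurable fun q : ℝ × (Fin p → ℝ) => q.1 := measurable_fst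
  have mYm : ∀ {u : ℝ × (Fin p → ℝ) → ℝ}, Measurable u → Measurable fun q => q.1 * u q :=
    fun hu => mY.mul hu
  have hYi : Integrable Y μ := by simpa using hYb (integrable_const (1 : ℝ))
  have hMeq : M = Matrix.of fun i j =>
        -4 * phiFun f * (β i * β j)
          + 4 * (1 + gaussMoment f 0 ^ 2) * (if i = j then 1 else 0) := by
    ext i j
    rw [hM, Matrix.of_apply]
    obtain ⟨a1, b1⟩ := tr _ (mXX i j) (hI2 i j)
    obtain ⟨a2, b2⟩ := T _ _ (mX i) (mX j) (hI1 i) (hI1 j)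
    obtain ⟨a3, b3⟩ := T _ _ (mX j) (mX i) (hI1 j) (hI1 i)
    obtain ⟨a4, b4⟩ := T _ _ (mYm (mXX i j)) mY (hYb (hI2 i j)) hYi
    obtain ⟨a5, b5⟩ := T _ _ mY (mYm (mXX i j)) hYi (hYb (hI2 i j))
    obtain ⟨a6, b6⟩ := T _ _ (mYm (mX i)) (mYm (mX j)) (hYb (hI1 i)) (hYb (hI1 j))
    obtain ⟨a7, b7⟩ := T _ _ (mYm (mX j)) (mYm (mX i)) (hYb (hI1 j)) (hYb (hI1 i))
    simp only [] at a1 a2 a3 a4 a5 a6 a7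
    simp only [h1, h2, y0, y1, y2] at b1 b2 b3 b4 b5 b6 b7
    have hE : (fun ω => (Y ω + Y' ω) ^ 2 * ((X ω i - X' ω i) * (X ω j - X' ω j))) =ᵐ[μ]
        fun ω => 2 * ((X ω i * X ω j + X' ω i * X' ω j - X ω i * X' ω j - X ω j * X' ω i)
          + (Y ω * (X ω i * X ω j) * Y' ω + Y ω * (Y' ω * (X' ω i * X' ω j))
            - Y ω * X ω i * (Y' ω * X' ω j) - Y ω * X ω j * (Y' ω * X' ω i))) := by
      filter_upwards [hY'val] with ω hω
      have e1 : Y ω ^ 2 = 1 := by rcases hYval ω with h | h <;> simp [h]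
      have e2 : Y' ω ^ 2 = 1 := by rcases hω with h | h <;> simp [h]
      have e3 : (Y ω + Y' ω) ^ 2 = 2 + 2 * (Y ω * Y' ω) := by
        rw [add_sq, e1, e2]; ring
      rw [e3]; ring
    rw [integral_congr_ae hE, integral_const_mul,
      integral_add ((((hI2 i j).fun_add a1).sub_lam a2).sub_lam a3) (((a4.fun_add a5).sub_lam a6).sub_lam a7),
      integral_sub (((hI2 i j).fun_add a1).sub_lam a2) a3, integral_sub ((hI2 i j).fun_add a1) a2,
      integral_add (hI2 i j) a1,
      integral_sub ((a4.fun_add a5).sub_lam a6) a7, integral_sub (a4.fun_add a5) a6, integral_add a4 a5,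
      b1, b2, b3, b4, b5, b6, b7, h2, phiFun]
    ring
  have hmv : ∀ v : Fin p → ℝ, M.mulVec v = fun i =>
      -4 * phiFun f * β i * (∑ j, v j * β j) + 4 * (1 + gaussMoment f 0 ^ 2) * v i := by
    intro v
    ext i
    rw [hMeq]
    simp only [Matrix.mulVec, dotProduct, Matrix.of_apply, add_mul, Finset.sum_add_distrib]
    congr 1
    · rw [Finset.mul_sum]
      exact Finset.sum_congr rfl fun j _ => by ring
    · simp
  refine ⟨hMeq, fun _ => ⟨?_, fun v hv => ?_⟩⟩
  · rw [hmv]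
    have : ∑ j, β j * β j = 1 := by rw [← hβ]; exact Finset.sum_congr rfl fun j _ => by ring
    ext i
    simp only [this, Pi.smul_apply, smul_eq_mul]
    ring
  · rw [hmv]
    ext i
    simp only [hv, Pi.smul_apply, smul_eq_mul]
    ring
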